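/- Let n=1 and ρ>2. If u∈ℋ^{1,−s} for some 3/2<s<(ρ+1)/2 satisfies (1+G₀W)u = βγ₀ for some β∈ℂ, then Pu=0 in the sense of distributions; in particular ⟨Wu,γ₀⟩=0. -/

import Mathlib

open MeasureTheory Real Complex Filter Topology

noncomputable section

/-- phase space ℝ²: `p.1` = position x, `p.2` = velocity v -/
abbrev Phase := ℝ × ℝ

/-- L²(ℝ²) -/
abbrev Hsp := Lp ℂ 2 (volume : Measure Phase)

/-- ⟨x⟩^s = (1+x²)^{s/2} -/
def jbr (s x : ℝ) : ℝ := (1 + x ^ 2) ^ (s / 2)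

/-- test functions on phase space -/
def IsTest (φ : Phase → ℂ) : Prop := ContDiff ℝ (⊤ : ℕ∞) φ ∧ HasCompactSupport φ

def dxD (u : Phase → ℂ) (p : Phase) : ℂ := fderiv ℝ u p (1, 0)
def dvD (u : Phase → ℂ) (p : Phase) : ℂ := fderiv ℝ u p (0, 1)

/-- formal transpose of P = v∂ₓ − ∂ᵥ² + v²/4 − 1/2 − V′(x)∂ᵥ w.r.t. the pairing ∫ u φ -/
def KFPt (V : ℝ → ℝ) (φ : Phase → ℂ) (p : Phase) : ℂ :=
  -((p.2 : ℂ) * dxD φ p) - dvD (dvD φ) p + ((p.2 ^ 2 / 4 - 1 / 2 : ℝ) : ℂ) * φ p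
    + ((deriv V p.1 : ℝ) : ℂ) * dvD φ p

def psi0 (v : ℝ) : ℝ := (2 * π) ^ (-(1:ℝ)/4) * Real.exp (-(v ^ 2) / 4)

def gam0 (p : Phase) : ℂ := (psi0 p.2 : ℝ)

def gamV (V : ℝ → ℝ) (p : Phase) : ℂ :=
  ((2 * π) ^ (-(1:ℝ)/4) * Real.exp (-(p.2 ^ 2 / 2 + V p.1) / 2) : ℝ)

/-- decay assumption (1.4) on the potential -/
def VDecay (V : ℝ → ℝ) (ρ : ℝ) : Prop :=
  ContDiff ℝ 1 V ∧ ∃ C : ℝ, ∀ x : ℝ, |V x| + jbr 1 x * |deriv V x| ≤ C * jbr (-ρ) x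

/-- Wu = −V′(x) g, where g is the (weak) ∂ᵥ-derivative of u -/
def Wfun (V : ℝ → ℝ) (g : Phase → ℂ) (p : Phase) : ℂ := -((deriv V p.1 : ℝ) : ℂ) * g p

/-- g is the weak ∂ᵥ-derivative of u -/
def WeakDv (u g : Phase → ℂ) : Prop :=
  ∀ φ : Phase → ℂ, IsTest φ → ∫ p : Phase, u p * dvD φ p = -∫ p : Phase, g p * φ p

/-- partial Fourier transform in the x-variable -/
def pftx (w : Phase → ℂ) (q : Phase) : ℂ :=
  ∫ x : ℝ, Complex.exp (-(((2 * π * x * q.1 : ℝ)) : ℂ) * Complex.I) * w (x, q.2)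

/-- the operator ⟨D_x⟩^{1/3} (acting on nice functions) -/
def opLamX (φ : Phase → ℂ) (p : Phase) : ℂ :=
  ∫ ξ : ℝ, Complex.exp ((((2 * π * p.1 * ξ : ℝ)) : ℂ) * Complex.I) *
    (((1 + (2 * π * ξ) ^ 2) ^ ((1:ℝ)/6) : ℝ) : ℂ) * pftx φ (ξ, p.2)

/-- L² norm -/
def L2n (f : Phase → ℂ) : ℝ := (∫ p : Phase, ‖f p‖ ^ 2).sqrt

/-- membership u ∈ ℋ^{1,s}, where g is the weak ∂ᵥ-derivative of u -/
def MemH1 (s : ℝ) (u g : Phase → ℂ) : Prop :=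
  AEStronglyMeasurable u (volume : Measure Phase) ∧
  AEStronglyMeasurable g (volume : Measure Phase) ∧ WeakDv u g ∧
  Integrable (fun p : Phase => ‖u p‖ ^ 2 * jbr (2 * s) p.1) ∧
  Integrable (fun p : Phase => ‖g p‖ ^ 2 * jbr (2 * s) p.1) ∧
  Integrable (fun p : Phase => p.2 ^ 2 * ‖u p‖ ^ 2 * jbr (2 * s) p.1) ∧
  ∃ M : ℝ, ∀ φ : Phase → ℂ, IsTest φ →
    ‖∫ p : Phase, (jbr s p.1 : ℂ) * u p * opLamX φ p‖ ≤ M * L2n φ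

/-- squared ℋ^{1,s}-norm (of a nice function): quadratic form of
(1−Δᵥ+v²+⟨D_x⟩^{2/3}) applied to ⟨x⟩^s h -/
def H1normSq (s : ℝ) (h : Phase → ℂ) : ℝ :=
  (∫ p : Phase, (‖(jbr s p.1 : ℂ) * h p‖ ^ 2
      + ‖dvD (fun q : Phase => (jbr s q.1 : ℂ) * h q) p‖ ^ 2
      + p.2 ^ 2 * ‖(jbr s p.1 : ℂ) * h p‖ ^ 2))
  + ∫ q : Phase, (1 + (2 * π * q.1) ^ 2) ^ ((1:ℝ)/3)
      * ‖pftx (fun p : Phase => (jbr s p.1 : ℂ) * h p) q‖ ^ 2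

def H1norm (s : ℝ) (h : Phase → ℂ) : ℝ := (H1normSq s h).sqrt

/-- "‖f‖_{ℋ^{-1,-s}} ≤ B" : f is B-bounded as a functional on ℋ^{1,s} -/
def DualBound (s : ℝ) (f : Phase → ℂ) (B : ℝ) : Prop :=
  ∀ h : Phase → ℂ, IsTest h → ‖∫ p : Phase, f p * h p‖ ≤ B * H1norm s h

def offRplus : Set ℂ := {z : ℂ | ¬(0 ≤ z.re ∧ z.im = 0)}

/-- branch of √z with Im √z > 0 for z ∉ [0,∞) -/
def sqrtBr (z : ℂ) : ℂ := if 0 ≤ z.im then z ^ ((1:ℂ)/2) else -(z ^ ((1:ℂ)/2))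

/-- R is (a) resolvent family for P = P₀ + W on the set S:
(P−z)(R z f) = f in the sense of distributions, for every f ∈ L². -/
def IsResolvent (V : ℝ → ℝ) (R : ℂ → Hsp →L[ℂ] Hsp) (S : Set ℂ) : Prop :=
  ∀ z ∈ S, ∀ f : Hsp, ∀ φ : Phase → ℂ, IsTest φ →
    ∫ p : Phase, (R z f) p * (KFPt V φ p - z * φ p) = ∫ p : Phase, (f : Phase → ℂ) p * φ p

/-- weighted L²-norm: norm of 𝓛^{2,s} -/
def wNorm (s : ℝ) (f : Phase → ℂ) : ℝ := (∫ p : Phase, ‖f p‖ ^ 2 * jbr (2 * s) p.1).sqrt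

/-- membership in 𝓛^{2,s} -/
def MemW (s : ℝ) (f : Phase → ℂ) : Prop :=
  AEStronglyMeasurable f (volume : Measure Phase) ∧
  Integrable (fun p : Phase => ‖f p‖ ^ 2 * jbr (2 * s) p.1)

/-- bilinear pairing ∫ f g -/
def pair (f g : Phase → ℂ) : ℂ := ∫ p : Phase, f p * g p

/-- w = G₀(Wu), where g is the weak ∂ᵥ-derivative of u (so that Wu = −V′(x)g) and G₀ is the
constant coefficient in the low-energy expansion R₀(z) = z^{−1/2}G₋₁ + G₀ + o(1) of the
free resolvent (Proposition 3.1): G₀(Wu) is the weak limit, tested against test functions,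
of (R₀(z) − z^{−1/2}G₋₁)(Wu) as z → 0, z ∉ [0,∞), where G₋₁ = (i/2)⟨·,γ₀⟩γ₀ and R is the
free resolvent family. -/
def IsG0W (V : ℝ → ℝ) (R : ℂ → Hsp →L[ℂ] Hsp) (g w : Phase → ℂ) : Prop :=
  AEStronglyMeasurable w (volume : Measure Phase) ∧
  ∃ WL : Hsp, (⇑WL) =ᵐ[volume] Wfun V g ∧
    ∀ φ : Phase → ℂ, IsTest φ →
      Tendsto (fun z : ℂ =>
          (∫ p : Phase, (R z WL) p * φ p)
            - (sqrtBr z)⁻¹ * (Complex.I / 2 * (∫ p : Phase, Wfun V g p * gam0 p)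
                * (∫ p : Phase, gam0 p * φ p)))
        (𝓝[offRplus] 0) (𝓝 (∫ p : Phase, w p * φ p))

lemma jbr_pos (s x : ℝ) : 0 < jbr s x := Real.rpow_pos_of_pos (by positivity) _

lemma continuous_jbr (s : ℝ) : Continuous (jbr s) := by
  unfold jbr
  exact (by fun_prop : Continuous fun x : ℝ => 1 + x ^ 2).rpow_const
    fun x => Or.inl (by positivity)

lemma jbr_mul (s t x : ℝ) : jbr s x * jbr t x = jbr (s + t) x := by
  unfold jbr
  rw [← Real.rpow_add (by positivity)]
  congr 1
  ring

lemma jbr_neg_le_of_abs_le {r x y : ℝ} (hr : 0 ≤ r) (h : |x| ≤ |y|) : jbr (-r) y ≤ jbr (-r) x := by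
  unfold jbr
  exact Real.rpow_le_rpow_of_nonpos (by positivity) (by linarith [sq_le_sq.2 h]) (by linarith)

lemma jbr_neg_le_one {r : ℝ} (hr : 0 ≤ r) (x : ℝ) : jbr (-r) x ≤ 1 := by
  simpa [jbr] using jbr_neg_le_of_abs_le hr (by simp : |(0 : ℝ)| ≤ |x|)

lemma one_le_jbr_one (x : ℝ) : 1 ≤ jbr 1 x := by
  unfold jbr
  exact Real.one_le_rpow (by nlinarith [sq_nonneg x]) (by norm_num)

/-- Functions in dual weighted `L²` spaces have an integrable product. -/
lemma integrable_mul_of_weighted {s : ℝ} {u F : Phase → ℂ}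
    (hum : AEStronglyMeasurable u (volume : Measure Phase))
    (hu : Integrable (fun p : Phase => ‖u p‖ ^ 2 * jbr (2 * -s) p.1))
    (hFm : AEStronglyMeasurable F (volume : Measure Phase))
    (hF : Integrable (fun p : Phase => ‖F p‖ ^ 2 * jbr (2 * s) p.1)) :
    Integrable (fun p => u p * F p) := by
  refine (hu.add hF).mono' (hum.mul hFm) (Eventually.of_forall fun p => ?_)
  have h1 : jbr (2 * -s) p.1 = jbr (-s) p.1 ^ 2 := by
    rw [sq, jbr_mul]; congr 1; ring
  have h2 : jbr (2 * s) p.1 = jbr s p.1 ^ 2 := by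
    rw [sq, jbr_mul]; congr 1; ring
  have h3 : jbr (-s) p.1 * jbr s p.1 = 1 := by
    rw [jbr_mul]; simp [jbr]
  have h4 := sq_nonneg (‖u p‖ * jbr (-s) p.1 - ‖F p‖ * jbr s p.1)
  have h5 : ‖u p‖ * jbr (-s) p.1 * (‖F p‖ * jbr s p.1) = ‖u p‖ * ‖F p‖ := by
    linear_combination (‖u p‖ * ‖F p‖) * h3
  have h6 : 0 ≤ ‖u p‖ * ‖F p‖ := by positivity
  simp only [Pi.add_apply, norm_mul, h1, h2]
  nlinarith

/-- Dominated convergence for pairings between dual weighted `L²` spaces. -/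
lemma tendsto_integral_mul_of_weighted {s : ℝ} {u : Phase → ℂ} {D : Phase → ℝ}
    {F : ℕ → Phase → ℂ} {G : Phase → ℂ}
    (hum : AEStronglyMeasurable u (volume : Measure Phase))
    (hu : Integrable (fun p : Phase => ‖u p‖ ^ 2 * jbr (2 * -s) p.1))
    (hDm : AEStronglyMeasurable D (volume : Measure Phase))
    (hD : Integrable (fun p : Phase => D p ^ 2 * jbr (2 * s) p.1))
    (hFm : ∀ n, AEStronglyMeasurable (F n) (volume : Measure Phase))
    (hFD : ∀ n p, ‖F n p‖ ≤ D p)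
    (hFG : ∀ p, Tendsto (fun n => F n p) atTop (𝓝 (G p))) :
    Tendsto (fun n => ∫ p, u p * F n p) atTop (𝓝 (∫ p, u p * G p)) := by
  have hi : Integrable (fun p => u p * (D p : ℂ)) :=
    integrable_mul_of_weighted hum hu (Complex.continuous_ofReal.comp_aestronglyMeasurable hDm)
      (by simpa using hD)
  refine tendsto_integral_of_dominated_convergence _ (fun n => hum.mul (hFm n)) hi.norm
    (fun n => Eventually.of_forall fun p => ?_)
    (Eventually.of_forall fun p => (hFG p).const_mul _)
  simp only [norm_mul, Complex.norm_real]
  exact mul_le_mul_of_nonneg_left ((hFD n p).trans (le_abs_self _)) (norm_nonneg _)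

lemma integrable_sq_mul_jbr_of_hasCompactSupport {F : Phase → ℂ} (hF : Continuous F)
    (hc : HasCompactSupport F) (r : ℝ) : Integrable (fun p : Phase => ‖F p‖ ^ 2 * jbr r p.1) := by
  refine Continuous.integrable_of_hasCompactSupport ?_ ?_
  · exact (hF.norm.pow 2).mul ((continuous_jbr r).comp continuous_fst)
  · exact hc.mono' fun p hp => subset_tsupport _ fun h => hp (by simp [h])

lemma integrable_mul_of_hasCompactSupport {s : ℝ} {u F : Phase → ℂ}
    (hum : AEStronglyMeasurable u (volume : Measure Phase))
    (hu : Integrable (fun p : Phase => ‖u p‖ ^ 2 * jbr (2 * -s) p.1))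
    (hF : Continuous F) (hc : HasCompactSupport F) : Integrable (fun p => u p * F p) :=
  integrable_mul_of_weighted hum hu hF.aestronglyMeasurable
    (integrable_sq_mul_jbr_of_hasCompactSupport hF hc _)

lemma integrable_Lp_mul {F : Phase → ℂ} (f : Hsp) (hF : Continuous F) (hc : HasCompactSupport F) :
    Integrable (fun p => f p * F p) :=
  MemLp.integrable_mul (q := 2) (Lp.memLp f) (hF.memLp_of_hasCompactSupport hc)

section Derivatives

variable {φ ψ : Phase → ℂ}

lemma ContDiff.dxD (h : ContDiff ℝ (⊤ : ℕ∞) φ) : ContDiff ℝ (⊤ : ℕ∞) (dxD φ) :=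
  (h.fderiv_right (by simp)).clm_apply contDiff_const

lemma ContDiff.dvD (h : ContDiff ℝ (⊤ : ℕ∞) φ) : ContDiff ℝ (⊤ : ℕ∞) (dvD φ) :=
  (h.fderiv_right (by simp)).clm_apply contDiff_const

lemma IsTest.dxD (h : IsTest φ) : IsTest (dxD φ) := ⟨h.1.dxD, h.2.fderiv_apply ℝ _⟩

lemma IsTest.dvD (h : IsTest φ) : IsTest (dvD φ) := ⟨h.1.dvD, h.2.fderiv_apply ℝ _⟩

lemma IsTest.mul_left (h : IsTest φ) (hψ : ContDiff ℝ (⊤ : ℕ∞) ψ) :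
    IsTest (fun p => ψ p * φ p) := ⟨hψ.mul h.1, h.2.mul_left⟩

lemma integral_mul_fderiv_apply (hψ : ContDiff ℝ (⊤ : ℕ∞) ψ) (h : IsTest φ) (e : Phase) :
    ∫ p, ψ p * fderiv ℝ φ p e = -∫ p, fderiv ℝ ψ p e * φ p := by
  have hψ' : Continuous fun p => fderiv ℝ ψ p e :=
    (hψ.continuous_fderiv (by simp)).clm_apply continuous_const
  have hφ' : Continuous fun p => fderiv ℝ φ p e :=
    (h.1.continuous_fderiv (by simp)).clm_apply continuous_const
  refine integral_mul_fderiv_eq_neg_fderiv_mul_of_integrable ?_ ?_ ?_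
    (fun x _ => hψ.differentiable (by simp) x) (fun x _ => h.1.differentiable (by simp) x)
  · exact (hψ'.mul h.1.continuous).integrable_of_hasCompactSupport h.2.mul_left
  · exact (hψ.continuous.mul hφ').integrable_of_hasCompactSupport
      (h.2.fderiv_apply ℝ e).mul_left
  · exact (hψ.continuous.mul h.1.continuous).integrable_of_hasCompactSupport h.2.mul_left

lemma integral_mul_dxD (hψ : ContDiff ℝ (⊤ : ℕ∞) ψ) (h : IsTest φ) :
    ∫ p, ψ p * _root_.dxD φ p = -∫ p, _root_.dxD ψ p * φ p :=
  integral_mul_fderiv_apply hψ h _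

lemma integral_mul_dvD (hψ : ContDiff ℝ (⊤ : ℕ∞) ψ) (h : IsTest φ) :
    ∫ p, ψ p * _root_.dvD φ p = -∫ p, _root_.dvD ψ p * φ p :=
  integral_mul_fderiv_apply hψ h _

end Derivatives

lemma hasFDerivAt_tensor {f k : ℝ → ℝ} {f' k' : ℝ} {p : Phase} (hf : HasDerivAt f f' p.1)
    (hk : HasDerivAt k k' p.2) :
    HasFDerivAt (fun q : Phase => ((f q.1 * k q.2 : ℝ) : ℂ))
      (Complex.ofRealCLM.comp (f p.1 • (k' • ContinuousLinearMap.snd ℝ ℝ ℝ)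
        + k p.2 • (f' • ContinuousLinearMap.fst ℝ ℝ ℝ))) p :=
  Complex.ofRealCLM.hasFDerivAt.comp p ((hf.comp_hasFDerivAt p hasFDerivAt_fst).mul
    (hk.comp_hasFDerivAt p hasFDerivAt_snd))

lemma dxD_tensor {f k : ℝ → ℝ} {f' k' : ℝ} {p : Phase} (hf : HasDerivAt f f' p.1)
    (hk : HasDerivAt k k' p.2) :
    dxD (fun q : Phase => ((f q.1 * k q.2 : ℝ) : ℂ)) p = ((f' * k p.2 : ℝ) : ℂ) := by
  rw [dxD, (hasFDerivAt_tensor hf hk).fderiv]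
  simp [mul_comm]

lemma dvD_tensor {f k : ℝ → ℝ} {f' k' : ℝ} {p : Phase} (hf : HasDerivAt f f' p.1)
    (hk : HasDerivAt k k' p.2) :
    dvD (fun q : Phase => ((f q.1 * k q.2 : ℝ) : ℂ)) p = ((f p.1 * k' : ℝ) : ℂ) := by
  rw [dvD, (hasFDerivAt_tensor hf hk).fderiv]
  simp

lemma hasDerivAt_psi0 (v : ℝ) : HasDerivAt psi0 (-v / 2 * psi0 v) v := by
  have h : HasDerivAt (fun v : ℝ => -(v ^ 2) / 4) (-v / 2) v := by
    refine ((hasDerivAt_pow 2 v).neg.div_const 4).congr_deriv ?_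
    push_cast; ring
  refine (h.exp.const_mul ((2 * π) ^ (-(1:ℝ)/4))).congr_deriv ?_
  rw [psi0]; ring

lemma hasDerivAt_deriv_psi0 (v : ℝ) :
    HasDerivAt (fun v => -v / 2 * psi0 v) ((v ^ 2 / 4 - 1 / 2) * psi0 v) v := by
  refine (((hasDerivAt_id v).neg.div_const 2).mul (hasDerivAt_psi0 v)).congr_deriv ?_
  simp only [Pi.neg_apply, id]; ring

lemma psi0_pos (v : ℝ) : 0 < psi0 v := by unfold psi0; positivity

lemma contDiff_psi0 : ContDiff ℝ (⊤ : ℕ∞) psi0 := by unfold psi0; fun_prop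

lemma contDiff_gam0 : ContDiff ℝ (⊤ : ℕ∞) gam0 :=
  Complex.ofRealCLM.contDiff.comp (contDiff_psi0.comp contDiff_snd)

lemma KFPt_zero (φ : Phase → ℂ) (p : Phase) : KFPt (fun _ => 0) φ p =
    -((p.2 : ℂ) * dxD φ p) - dvD (dvD φ) p + ((p.2 ^ 2 / 4 - 1 / 2 : ℝ) : ℂ) * φ p := by
  simp [KFPt]

lemma KFPt_eq (V : ℝ → ℝ) (φ : Phase → ℂ) (p : Phase) :
    KFPt V φ p = KFPt (fun _ => 0) φ p + ((deriv V p.1 : ℝ) : ℂ) * dvD φ p := by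
  rw [KFPt_zero, KFPt]

lemma IsTest.add {φ ψ : Phase → ℂ} (h : IsTest φ) (h' : IsTest ψ) :
    IsTest (fun p => φ p + ψ p) := ⟨h.1.add h'.1, h.2.add h'.2⟩

lemma IsTest.KFPt_zero {φ : Phase → ℂ} (h : IsTest φ) : IsTest (KFPt (fun _ => 0) φ) := by
  have h1 := h.dxD.mul_left (ψ := fun p => -(p.2 : ℂ))
    (Complex.ofRealCLM.contDiff.comp contDiff_snd).neg
  have h2 := h.dvD.dvD.mul_left (ψ := fun _ => (-1 : ℂ)) contDiff_const
  have h3 := h.mul_left (ψ := fun p => ((p.2 ^ 2 / 4 - 1 / 2 : ℝ) : ℂ))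
    (Complex.ofRealCLM.contDiff.comp
      (((contDiff_snd.pow 2).div_const 4).sub contDiff_const))
  convert (h1.add h2).add h3 using 2 with p
  rw [_root_.KFPt_zero]; ring

/-- `γ₀` is annihilated by the free operator. -/
lemma integral_gam0_mul_KFPt_zero {φ : Phase → ℂ} (h : IsTest φ) :
    ∫ p, gam0 p * KFPt (fun _ => 0) φ p = 0 := by
  have e0 : gam0 = fun q : Phase => (((fun _ => 1 : ℝ → ℝ) q.1 * psi0 q.2 : ℝ) : ℂ) := by
    ext p; simp [gam0]
  have d1 : dvD gam0 = fun q : Phase =>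
      (((fun _ => 1 : ℝ → ℝ) q.1 * (fun v => -v / 2 * psi0 v) q.2 : ℝ) : ℂ) := by
    ext p
    rw [e0, dvD_tensor (hasDerivAt_const _ _) (hasDerivAt_psi0 _)]
  have d2 (p : Phase) : dvD (dvD gam0) p = ((p.2 ^ 2 / 4 - 1 / 2 : ℝ) : ℂ) * gam0 p := by
    rw [d1, dvD_tensor (hasDerivAt_const _ _) (hasDerivAt_deriv_psi0 _)]
    simp [gam0]
  have hv : ContDiff ℝ (⊤ : ℕ∞) fun p : Phase => (p.2 : ℂ) * gam0 p :=
    (Complex.ofRealCLM.contDiff.comp contDiff_snd).mul contDiff_gam0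
  have d3 (p : Phase) : dxD (fun p : Phase => (p.2 : ℂ) * gam0 p) p = 0 := by
    have : (fun p : Phase => (p.2 : ℂ) * gam0 p) = fun q : Phase =>
        (((fun _ => 1 : ℝ → ℝ) q.1 * (fun v => v * psi0 v) q.2 : ℝ) : ℂ) := by
      ext p; simp [gam0]
    rw [this, dxD_tensor (k := fun v => v * psi0 v) (hasDerivAt_const _ _)
      ((hasDerivAt_id p.2).mul (hasDerivAt_psi0 _))]
    simp
  have i1 : ∫ p : Phase, (p.2 : ℂ) * gam0 p * dxD φ p = 0 := by
    rw [integral_mul_dxD hv h]; simp [d3]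
  have i2 : ∫ p, gam0 p * dvD (dvD φ) p
      = ∫ p : Phase, ((p.2 ^ 2 / 4 - 1 / 2 : ℝ) : ℂ) * gam0 p * φ p := by
    rw [integral_mul_dvD contDiff_gam0 h.dvD, integral_mul_dvD contDiff_gam0.dvD h, neg_neg]
    simp only [d2]
  have hint {ψ χ : Phase → ℂ} (hψ : ContDiff ℝ (⊤ : ℕ∞) ψ) (hχ : IsTest χ) :
      Integrable fun p => ψ p * χ p :=
    (hχ.mul_left hψ).1.continuous.integrable_of_hasCompactSupport (hχ.mul_left hψ).2
  have hq : ContDiff ℝ (⊤ : ℕ∞) fun p : Phase => ((p.2 ^ 2 / 4 - 1 / 2 : ℝ) : ℂ) * gam0 p :=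
    (Complex.ofRealCLM.contDiff.comp
      (((contDiff_snd.pow 2).div_const 4).sub contDiff_const)).mul contDiff_gam0
  calc ∫ p, gam0 p * KFPt (fun _ => 0) φ p
      = ∫ p : Phase, (-((p.2 : ℂ) * gam0 p * dxD φ p) - gam0 p * dvD (dvD φ) p)
        + ((p.2 ^ 2 / 4 - 1 / 2 : ℝ) : ℂ) * gam0 p * φ p := by
        congr 1; ext p; rw [_root_.KFPt_zero]; ring
    _ = 0 := by
        have a := hint hv h.dxD
        have b := hint contDiff_gam0 h.dvD.dvD
        have c := hint hq h
        rw [integral_add (f := fun p : Phase => -((p.2 : ℂ) * gam0 p * dxD φ p)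
            - gam0 p * dvD (dvD φ) p) (a.neg.sub b) c, integral_sub (f := fun p : Phase => -((p.2 : ℂ) * gam0 p * dxD φ p))
            a.neg b, integral_neg, i1, i2]
        simp

lemma sqrtBr_sq (z : ℂ) : sqrtBr z ^ 2 = z := by
  have h : (z ^ ((1:ℂ)/2)) ^ 2 = z := by
    simp
  unfold sqrtBr
  split_ifs <;> simp only [neg_sq, h]

lemma tendsto_mul_inv_sqrtBr : Tendsto (fun z : ℂ => z * (sqrtBr z)⁻¹) (𝓝 0) (𝓝 0) := by
  have h (z : ℂ) : ‖z * (sqrtBr z)⁻¹‖ = √‖z‖ := by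
    have h1 : ‖sqrtBr z‖ ^ 2 = ‖z‖ := by rw [← norm_pow, sqrtBr_sq]
    have h2 : z * (sqrtBr z)⁻¹ = sqrtBr z := by
      nth_rw 1 [← sqrtBr_sq z]
      rw [sq, mul_assoc]
      by_cases h0 : sqrtBr z = 0
      · simp [h0]
      · rw [mul_inv_cancel₀ h0, mul_one]
    rw [h2, ← h1, Real.sqrt_sq (norm_nonneg _)]
  rw [tendsto_zero_iff_norm_tendsto_zero]
  simp only [h]
  have : Continuous fun z : ℂ => √‖z‖ := by fun_prop
  simpa using this.tendsto 0

instance : (𝓝[offRplus] (0 : ℂ)).NeBot := by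
  rw [← mem_closure_iff_nhdsWithin_neBot]
  have h : Tendsto (fun n : ℕ => ((-(1 / ((n : ℝ) + 1)) : ℝ) : ℂ)) atTop (𝓝 0) := by
    have := (Complex.continuous_ofReal.tendsto _).comp
      (tendsto_one_div_add_atTop_nhds_zero_nat (𝕜 := ℝ)).neg
    simpa [Function.comp_def] using this
  refine mem_closure_of_tendsto h (Eventually.of_forall fun n => ?_)
  change ¬(0 ≤ (-(1 / ((n : ℝ) + 1))) ∧ _)
  have : 0 < 1 / ((n : ℝ) + 1) := by positivity
  intro hn
  linarith [hn.1]

/-- `P₀G₀W = W`: the equation satisfied by the constant term of the resolvent expansion. -/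
lemma IsG0W.integral_mul_KFPt_zero {V : ℝ → ℝ} {R : ℂ → Hsp →L[ℂ] Hsp} {g w : Phase → ℂ}
    (hR : IsResolvent (fun _ => 0) R offRplus) (hw : IsG0W V R g w) {φ : Phase → ℂ}
    (hφ : IsTest φ) : ∫ p, w p * KFPt (fun _ => 0) φ p = ∫ p, Wfun V g p * φ p := by
  obtain ⟨-, WL, hWL, hlim⟩ := hw
  have hl := hlim _ hφ.KFPt_zero
  simp only [integral_gam0_mul_KFPt_zero hφ, mul_zero, sub_zero] at hl
  have hz : Tendsto (fun z : ℂ => z) (𝓝[offRplus] 0) (𝓝 0) := nhdsWithin_le_nhds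
  have h2 := ((hz.mul (hlim φ hφ)).add ((tendsto_mul_inv_sqrtBr.mono_left
    (nhdsWithin_le_nhds (s := offRplus))).mul_const (Complex.I / 2 *
      (∫ p : Phase, Wfun V g p * gam0 p) * (∫ p : Phase, gam0 p * φ p)))).const_add
      (∫ p, Wfun V g p * φ p)
  simp only [zero_mul, add_zero] at h2
  refine tendsto_nhds_unique hl (h2.congr' ?_)
  filter_upwards [self_mem_nhdsWithin] with z hz
  have e1 := hR z hz WL φ hφ
  have e2 : ∫ p, WL p * φ p = ∫ p, Wfun V g p * φ p := by
    refine integral_congr_ae ?_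
    filter_upwards [hWL] with p hp
    rw [hp]
  have e3 : ∫ p, (R z WL) p * (KFPt (fun _ => 0) φ p - z * φ p)
      = (∫ p, (R z WL) p * KFPt (fun _ => 0) φ p) - z * ∫ p, (R z WL) p * φ p := by
    rw [← integral_const_mul, ← integral_sub]
    · congr 1; ext p; ring
    · exact integrable_Lp_mul _ hφ.KFPt_zero.1.continuous hφ.KFPt_zero.2
    · exact (integrable_Lp_mul _ hφ.1.continuous hφ.2).const_mul z
  rw [← e2, ← e1, e3]
  ring

lemma exists_polynomial_seq {f : ℝ → ℝ} (hf : Continuous f) (M : ℝ) :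
    ∃ q : ℕ → Polynomial ℝ, ∀ n x, |x| ≤ M → |(q n).eval x - f x| < 1 / ((n : ℝ) + 1) := by
  have h (n : ℕ) := exists_polynomial_near_of_continuousOn (-M) M f hf.continuousOn
    (1 / ((n : ℝ) + 1)) (by positivity)
  choose q hq using h
  exact ⟨q, fun n x hx => hq n x (abs_le.1 hx)⟩

lemma IsTest.exists_bound_fst {φ : Phase → ℂ} (h : IsTest φ) :
    ∃ M, ∀ p : Phase, M < |p.1| → φ p = 0 := by
  obtain ⟨M, hM⟩ := h.2.isCompact.isBounded.exists_norm_le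
  refine ⟨M, fun p hp => image_eq_zero_of_notMem_tsupport fun hm => ?_⟩
  have := (norm_fst_le p).trans (hM p hm)
  rw [Real.norm_eq_abs] at this
  linarith

/-- Approximating a continuous coefficient by polynomials in pairings with a test function. -/
lemma tendsto_integral_mul_polynomial {s M : ℝ} {u φ : Phase → ℂ} {f : ℝ → ℝ}
    {q : ℕ → Polynomial ℝ} (hf : Continuous f)
    (hq : ∀ n x, |x| ≤ M → |(q n).eval x - f x| < 1 / ((n : ℝ) + 1))
    (hum : AEStronglyMeasurable u (volume : Measure Phase))
    (hu : Integrable (fun p : Phase => ‖u p‖ ^ 2 * jbr (2 * -s) p.1))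
    (h : IsTest φ) (hM : ∀ p : Phase, M < |p.1| → φ p = 0) :
    Tendsto (fun n => ∫ p : Phase, u p * ((((q n).eval p.1 : ℝ) : ℂ) * φ p)) atTop
      (𝓝 (∫ p : Phase, u p * (((f p.1 : ℝ) : ℂ) * φ p))) := by
  have hfφ : Continuous fun p : Phase => (((|f p.1| + 1 : ℝ) : ℂ)) * φ p :=
    (Complex.continuous_ofReal.comp (by fun_prop)).mul h.1.continuous
  refine tendsto_integral_mul_of_weighted (s := s)
    (D := fun p : Phase => ‖(((|f p.1| + 1 : ℝ) : ℂ)) * φ p‖) hum hu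
    hfφ.norm.aestronglyMeasurable
    (integrable_sq_mul_jbr_of_hasCompactSupport hfφ h.2.mul_left _) (fun n => ?_)
    (fun n p => ?_) fun p => ?_
  · exact ((Complex.continuous_ofReal.comp ((q n).continuous.comp continuous_fst)).mul
      h.1.continuous).aestronglyMeasurable
  · by_cases hp : M < |p.1|
    · simp [hM p hp]
    · have h1 := hq n p.1 (not_lt.1 hp)
      have h2 : 1 / ((n : ℝ) + 1) ≤ 1 := by
        rw [div_le_one (by positivity)]; linarith [(Nat.cast_nonneg n : (0 : ℝ) ≤ n)]
      have h3 := abs_sub_abs_le_abs_sub ((q n).eval p.1) (f p.1)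
      rw [norm_mul, norm_mul, Complex.norm_real, Complex.norm_real, Real.norm_eq_abs,
        Real.norm_eq_abs, abs_of_nonneg (by positivity : 0 ≤ |f p.1| + 1)]
      exact mul_le_mul_of_nonneg_right (by linarith) (norm_nonneg _)
  · by_cases hp : M < |p.1|
    · simp [hM p hp]
    · refine Tendsto.mul_const _ ((Complex.continuous_ofReal.tendsto _).comp ?_)
      rw [tendsto_iff_dist_tendsto_zero]
      exact squeeze_zero (fun _ => dist_nonneg) (fun n => (hq n p.1 (not_lt.1 hp)).le)
        tendsto_one_div_add_atTop_nhds_zero_nat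

/-- Weak `v`-derivatives commute with multiplication by a continuous function of `x`. -/
lemma WeakDv.integral_mul_continuous {s : ℝ} {u g φ : Phase → ℂ} {f : ℝ → ℝ} (hw : WeakDv u g)
    (hum : AEStronglyMeasurable u (volume : Measure Phase))
    (hgm : AEStronglyMeasurable g (volume : Measure Phase))
    (hu : Integrable (fun p : Phase => ‖u p‖ ^ 2 * jbr (2 * -s) p.1))
    (hg : Integrable (fun p : Phase => ‖g p‖ ^ 2 * jbr (2 * -s) p.1))
    (hf : Continuous f) (h : IsTest φ) :
    ∫ p : Phase, u p * (((f p.1 : ℝ) : ℂ) * dvD φ p)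
      = -∫ p : Phase, g p * (((f p.1 : ℝ) : ℂ) * φ p) := by
  obtain ⟨M₁, hM₁⟩ := h.exists_bound_fst
  obtain ⟨M₂, hM₂⟩ := h.dvD.exists_bound_fst
  obtain ⟨q, hq⟩ := exists_polynomial_seq hf (max M₁ M₂)
  have l1 := tendsto_integral_mul_polynomial hf hq hum hu h.dvD
    fun p hp => hM₂ p ((le_max_right _ _).trans_lt hp)
  have l2 := tendsto_integral_mul_polynomial hf hq hgm hg h
    fun p hp => hM₁ p ((le_max_left _ _).trans_lt hp)
  refine tendsto_nhds_unique l1 (l2.neg.congr fun n => ?_)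
  have hqs : ContDiff ℝ (⊤ : ℕ∞) fun p : Phase => (((q n).eval p.1 : ℝ) : ℂ) :=
    Complex.ofRealCLM.contDiff.comp ((q n).contDiff_aeval _ |>.comp contDiff_fst)
  rw [← hw _ (h.mul_left hqs)]
  congr 1; ext p; congr 1
  have hd : HasFDerivAt (fun p : Phase => (((q n).eval p.1 : ℝ) : ℂ))
      (Complex.ofRealCLM.comp ((q n).derivative.eval p.1 • ContinuousLinearMap.fst ℝ ℝ ℝ)) p :=
    Complex.ofRealCLM.hasFDerivAt.comp p
      (((q n).hasDerivAt p.1).comp_hasFDerivAt p hasFDerivAt_fst)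
  rw [dvD, (hd.fun_mul (h.1.differentiable (by simp) p).hasFDerivAt).fderiv]
  simp [dvD]

lemma IsTest.continuous_KFPt {V : ℝ → ℝ} {φ : Phase → ℂ} (hV : Continuous (deriv V))
    (h : IsTest φ) : Continuous (KFPt V φ) := by
  rw [funext (KFPt_eq V φ)]
  exact h.KFPt_zero.1.continuous.add
    ((Complex.continuous_ofReal.comp (hV.comp continuous_fst)).mul h.dvD.1.continuous)

lemma IsTest.tensor {f k : ℝ → ℝ} (hf : ContDiff ℝ (⊤ : ℕ∞) f) (hk : ContDiff ℝ (⊤ : ℕ∞) k)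
    (hfc : HasCompactSupport f) (hkc : HasCompactSupport k) :
    IsTest (fun q : Phase => ((f q.1 * k q.2 : ℝ) : ℂ)) := by
  refine ⟨Complex.ofRealCLM.contDiff.comp
    ((hf.comp contDiff_fst).mul (hk.comp contDiff_snd)), ?_⟩
  refine HasCompactSupport.intro (hfc.isCompact.prod hkc.isCompact) fun p hp => ?_
  rw [Set.mem_prod, not_and_or] at hp
  rcases hp with hp | hp <;> simp [image_eq_zero_of_notMem_tsupport hp]

lemma KFPt_tensor (V : ℝ → ℝ) {f f₁ k k₁ k₂ : ℝ → ℝ} (hf : ∀ x, HasDerivAt f (f₁ x) x)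
    (hk : ∀ v, HasDerivAt k (k₁ v) v) (hk₁ : ∀ v, HasDerivAt k₁ (k₂ v) v) (p : Phase) :
    KFPt V (fun q : Phase => ((f q.1 * k q.2 : ℝ) : ℂ)) p =
      ((-(p.2 * (f₁ p.1 * k p.2)) - f p.1 * k₂ p.2 + (p.2 ^ 2 / 4 - 1 / 2) * (f p.1 * k p.2)
        + deriv V p.1 * (f p.1 * k₁ p.2) : ℝ) : ℂ) := by
  have h : dvD (fun q : Phase => ((f q.1 * k q.2 : ℝ) : ℂ))
      = fun q : Phase => ((f q.1 * k₁ q.2 : ℝ) : ℂ) :=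
    funext fun q => dvD_tensor (hf _) (hk _)
  rw [KFPt, h, dxD_tensor (hf _) (hk _), dvD_tensor (hf _) (hk₁ _)]
  push_cast
  ring

/-- Smooth cutoffs at scale `N`, with two derivatives bounded uniformly in `N`. -/
lemma exists_cutoff : ∃ B : ℝ, 0 ≤ B ∧ ∀ N : ℝ, 1 ≤ N → ∃ χ χ₁ χ₂ : ℝ → ℝ,
    ContDiff ℝ (⊤ : ℕ∞) χ ∧ HasCompactSupport χ ∧
    (∀ x, HasDerivAt χ (χ₁ x) x) ∧ (∀ x, HasDerivAt χ₁ (χ₂ x) x) ∧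
    (∀ x, |χ x| ≤ 1 ∧ |χ₁ x| ≤ B ∧ |χ₂ x| ≤ B) ∧
    (∀ x, 2 * N < |x| → χ x = 0 ∧ χ₁ x = 0) ∧
    (∀ x, |x| < N → χ x = 1 ∧ χ₁ x = 0 ∧ χ₂ x = 0) := by
  let b : ContDiffBump (0 : ℝ) := ⟨1, 2, one_pos, one_lt_two⟩
  have hb : ContDiff ℝ (⊤ : ℕ∞) b := b.contDiff
  have hb₁ : ContDiff ℝ (⊤ : ℕ∞) (deriv b) := (contDiff_infty_iff_deriv.1 hb).2
  have hb₂ : ContDiff ℝ (⊤ : ℕ∞) (deriv (deriv b)) := (contDiff_infty_iff_deriv.1 hb₁).2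
  have hc : HasCompactSupport b := b.hasCompactSupport
  obtain ⟨B₁, hB₁⟩ := hc.deriv.exists_bound_of_continuous hb₁.continuous
  obtain ⟨B₂, hB₂⟩ := hc.deriv.deriv.exists_bound_of_continuous hb₂.continuous
  have hB₁0 : 0 ≤ B₁ := (norm_nonneg _).trans (hB₁ 0)
  have hB₂0 : 0 ≤ B₂ := (norm_nonneg _).trans (hB₂ 0)
  refine ⟨B₁ + B₂, by positivity, fun N hN => ?_⟩
  have hN0 : 0 < N := by linarith
  have hdiv {y C : ℝ} (h : |y| ≤ C) : |y / N| ≤ C := by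
    rw [abs_div, abs_of_pos hN0, div_le_iff₀ hN0]
    nlinarith [abs_nonneg y]
  have hN' (x : ℝ) : HasDerivAt (fun x => x / N) (1 / N) x := (hasDerivAt_id x).div_const N
  refine ⟨fun x => b (x / N), fun x => deriv b (x / N) / N,
    fun x => deriv (deriv b) (x / N) / N / N, hb.comp (contDiff_id.div_const N), ?_,
    fun x => ?_, fun x => ?_, fun x => ⟨?_, ?_, ?_⟩, fun x hx => ?_, fun x hx => ?_⟩
  · refine HasCompactSupport.intro (isCompact_Icc (a := -(2 * N)) (b := 2 * N)) fun x hx => ?_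
    refine b.zero_of_le_dist ?_
    rw [Set.mem_Icc, ← abs_le, not_le] at hx
    rw [Real.dist_eq, sub_zero, abs_div, abs_of_pos hN0, le_div_iff₀ hN0]
    exact hx.le
  · exact ((hb.differentiable (by simp) _).hasDerivAt.comp x (hN' x)).congr_deriv (by ring)
  · exact (((hb₁.differentiable (by simp) _).hasDerivAt.comp x (hN' x)).div_const N).congr_deriv
      (by ring)
  · rw [abs_of_nonneg b.nonneg]; exact b.le_one
  · exact hdiv ((hB₁ _).trans (by linarith))
  · exact hdiv (hdiv ((hB₂ _).trans (by linarith)))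
  · have hx' : x / N ∉ tsupport b := by
      rw [b.tsupport_eq, Metric.mem_closedBall, not_le, Real.dist_eq, sub_zero, abs_div,
        abs_of_pos hN0, lt_div_iff₀ hN0]
      exact hx
    refine ⟨image_eq_zero_of_notMem_tsupport hx', ?_⟩
    simp only [Function.notMem_support.1 fun h => hx' (support_deriv_subset h), zero_div]
  · have hx' : x / N ∈ Metric.ball (0 : ℝ) 1 := by
      rw [Metric.mem_ball, Real.dist_eq, sub_zero, abs_div, abs_of_pos hN0, div_lt_iff₀ hN0]
      linarith
    have he : b =ᶠ[𝓝 (x / N)] fun _ => 1 := by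
      filter_upwards [Metric.isOpen_ball.mem_nhds hx'] with y hy
      exact b.one_of_mem_closedBall (Metric.ball_subset_closedBall hy)
    refine ⟨he.eq_of_nhds, ?_, ?_⟩
    · simp [he.deriv_eq]
    · simp [he.deriv.deriv_eq]

/-- Local smooth approximation of a `C¹` function in the `C¹` norm. -/
lemma exists_smooth_approx {f : ℝ → ℝ} (hf : ContDiff ℝ 1 f) {M ε : ℝ} (hM : 0 ≤ M) (hε : 0 < ε) :
    ∃ h : ℝ → ℝ, ContDiff ℝ (⊤ : ℕ∞) h ∧
      ∀ x, |x| ≤ M → |h x - f x| ≤ ε ∧ |deriv h x - deriv f x| ≤ ε := by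
  have hf' : Continuous (deriv f) := hf.continuous_deriv le_rfl
  obtain ⟨q, hq⟩ := exists_polynomial_near_of_continuousOn (-M) M (deriv f) hf'.continuousOn
    (ε / (M + 1)) (by positivity)
  let h : ℝ → ℝ := fun x => f 0 + ∫ t in (0 : ℝ)..x, q.eval t
  have hd (x : ℝ) : HasDerivAt h (q.eval x) x :=
    (intervalIntegral.integral_hasDerivAt_right (q.continuous.intervalIntegrable _ _)
      q.continuous.stronglyMeasurable.stronglyMeasurableAtFilter
      q.continuous.continuousAt).const_add _
  have hh : deriv h = fun x => q.eval x := funext fun x => (hd x).deriv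
  have hε' : ε / (M + 1) ≤ ε := div_le_self hε.le (by linarith)
  refine ⟨h, contDiff_infty_iff_deriv.2 ⟨fun x => (hd x).differentiableAt, ?_⟩,
    fun x hx => ⟨?_, ?_⟩⟩
  · rw [hh]; exact q.contDiff_aeval _
  · have key := (convex_Icc (-M) M).norm_image_sub_le_of_norm_hasDerivWithin_le
      (f := fun x => h x - f x) (f' := fun x => q.eval x - deriv f x) (C := ε / (M + 1))
      (x := 0) (y := x)
      (fun y _ => ((hd y).sub (hf.differentiable (by simp) y).hasDerivAt).hasDerivWithinAt)
      (fun y hy => (hq y hy).le) ⟨by linarith, hM⟩ (abs_le.1 hx)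
    have h0 : h 0 - f 0 = 0 := by simp [h]
    rw [h0, sub_zero, sub_zero, Real.norm_eq_abs, Real.norm_eq_abs] at key
    refine key.trans ?_
    rw [div_mul_eq_mul_div, div_le_iff₀ (by positivity)]
    nlinarith [abs_nonneg x]
  · rw [hh]
    exact (hq x (abs_le.1 hx)).le.trans hε'

lemma one_add_abs_mul_psi0_le (v : ℝ) :
    (1 + |v|) * psi0 v ≤ 4 * psi0 0 * Real.exp (-(v ^ 2) / 8) := by
  have h1 : psi0 v = psi0 0 * (Real.exp (-(v ^ 2) / 8) * Real.exp (-(v ^ 2) / 8)) := by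
    rw [← Real.exp_add, psi0, psi0]
    simp only [ne_eq, OfNat.ofNat_ne_zero, not_false_eq_true, zero_pow, neg_zero, zero_div,
      Real.exp_zero, mul_one]
    congr 2; ring
  have h2 : (1 + |v|) * Real.exp (-(v ^ 2) / 8) ≤ 4 := by
    have h3 : 1 + |v| ≤ 4 * Real.exp (v ^ 2 / 8) := by
      nlinarith [Real.add_one_le_exp (v ^ 2 / 8), sq_abs v, sq_nonneg (|v| - 1)]
    calc (1 + |v|) * Real.exp (-(v ^ 2) / 8)
        ≤ 4 * Real.exp (v ^ 2 / 8) * Real.exp (-(v ^ 2) / 8) :=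
          mul_le_mul_of_nonneg_right h3 (Real.exp_pos _).le
      _ = 4 := by rw [mul_assoc, ← Real.exp_add]; ring_nf; simp
  rw [h1]
  have h4 : 0 ≤ psi0 0 * Real.exp (-(v ^ 2) / 8) :=
    mul_nonneg (psi0_pos 0).le (Real.exp_pos _).le
  nlinarith

lemma integrable_weighted_gaussian {ρ s : ℝ} (h : s < ρ - 1 / 2) (L : ℝ) :
    Integrable (fun p : Phase =>
      (L * (jbr (-ρ) p.1 * Real.exp (-(p.2 ^ 2) / 8))) ^ 2 * jbr (2 * s) p.1) := by
  have h1 : Integrable (fun x : ℝ => (1 + ‖x‖ ^ 2) ^ (-(2 * (ρ - s)) / 2)) :=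
    integrable_rpow_neg_one_add_norm_sq (by simp; linarith)
  have h2 : Integrable (fun v : ℝ => Real.exp (-(1 / 4) * v ^ 2)) :=
    integrable_exp_neg_mul_sq (by norm_num)
  refine ((h1.mul_prod h2).const_mul (L ^ 2)).congr (Eventually.of_forall fun p => ?_)
  have e1 : (1 + ‖p.1‖ ^ 2) ^ (-(2 * (ρ - s)) / 2)
      = jbr (-ρ) p.1 * jbr (-ρ) p.1 * jbr (2 * s) p.1 := by
    rw [jbr_mul, jbr_mul, jbr, Real.norm_eq_abs, sq_abs]
    congr 1; ring
  have e2 : Real.exp (-(1 / 4) * p.2 ^ 2)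
      = Real.exp (-(p.2 ^ 2) / 8) * Real.exp (-(p.2 ^ 2) / 8) := by
    rw [← Real.exp_add]; congr 1; ring
  simp only [e1, e2]
  ring

lemma VDecay.exists_bound {V : ℝ → ℝ} {ρ : ℝ} (hρ : 0 ≤ ρ) (hV : VDecay V ρ) :
    ∃ K : ℝ, 0 ≤ K ∧ ∀ x, |1 - Real.exp (-V x / 2)| ≤ K * jbr (-ρ) x ∧
      |deriv V x / 2 * Real.exp (-V x / 2)| ≤ K * jbr (-ρ) x ∧ |deriv V x| ≤ K * jbr (-ρ) x := by
  obtain ⟨-, C, hC⟩ := hV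
  have hC0 : 0 ≤ C := by
    have h := hC 0
    simp only [jbr] at h
    norm_num at h
    linarith [abs_nonneg (V 0), abs_nonneg (deriv V 0)]
  have hV1 (x : ℝ) : |V x| ≤ C * jbr (-ρ) x := by
    linarith [hC x, mul_nonneg (jbr_pos 1 x).le (abs_nonneg (deriv V x))]
  have hV2 (x : ℝ) : |deriv V x| ≤ C * jbr (-ρ) x := by
    nlinarith [hC x, abs_nonneg (V x), abs_nonneg (deriv V x), one_le_jbr_one x]
  have hV3 (x : ℝ) : |V x| ≤ C := (hV1 x).trans (by nlinarith [jbr_neg_le_one hρ x])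
  have hE (x : ℝ) : Real.exp (-V x / 2) ≤ Real.exp C :=
    Real.exp_le_exp.2 (by linarith [neg_abs_le (V x), hV3 x])
  have hE1 : 1 ≤ Real.exp C := Real.one_le_exp hC0
  refine ⟨C * Real.exp C, by positivity, fun x => ⟨?_, ?_, ?_⟩⟩
  · have h1 : |1 - Real.exp (-V x / 2)| ≤ |V x| * Real.exp C := by
      have a := Real.add_one_le_exp (-V x / 2)
      have b := Real.add_one_le_exp (V x / 2)
      have c : Real.exp (-V x / 2) * Real.exp (V x / 2) = 1 := by
        rw [← Real.exp_add]; ring_nf; simp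
      have d := Real.exp_pos (-V x / 2)
      have e := le_abs_self (V x)
      have f := neg_abs_le (V x)
      rw [abs_le]
      constructor
      · nlinarith [hE x, mul_le_mul_of_nonneg_left b d.le, mul_le_mul_of_nonneg_left (hE x)
          (abs_nonneg (V x)), mul_le_mul_of_nonneg_left e d.le, mul_le_mul_of_nonneg_left f d.le]
      · nlinarith [abs_nonneg (V x)]
    nlinarith [hV1 x]
  · rw [abs_mul, abs_div, abs_of_pos (Real.exp_pos _), abs_two]
    have := mul_le_mul (hV2 x) (hE x) (Real.exp_pos _).le ((abs_nonneg _).trans (hV2 x))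
    nlinarith [mul_nonneg (abs_nonneg (deriv V x)) (Real.exp_pos (-V x / 2)).le]
  · nlinarith [hV2 x, mul_nonneg hC0 (jbr_pos (-ρ) x).le]

lemma abs_cutoff_expr_le {v f f₁ a a₁ a₂ b g J A B K : ℝ} (hB : 0 ≤ B) (hK : 0 ≤ K)
    (hJ : 0 ≤ J) (hA : 0 ≤ A) (hg : 0 ≤ g) (hf : |f| ≤ A * J) (hf₁ : |f₁| ≤ A * J) (ha : |a| ≤ 1)
    (ha₁ : |a₁| ≤ B) (ha₂ : |a₂| ≤ B) (hb : |b| ≤ K) :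
    |-(v * f₁ * a) * g - f * (a₂ - v * a₁) * g + b * f * (a₁ - v / 2 * a) * g|
      ≤ A * (1 + B) * (2 + K) * (J * ((1 + |v|) * g)) := by
  have hv := abs_nonneg v
  have h1 : |v * f₁ * a| ≤ |v| * (A * J) := by
    rw [abs_mul, abs_mul]
    calc |v| * |f₁| * |a| ≤ |v| * (A * J) * 1 := by gcongr
      _ = _ := mul_one _
  have h2 : |f * (a₂ - v * a₁)| ≤ A * J * (B + |v| * B) := by
    rw [abs_mul]
    have : |a₂ - v * a₁| ≤ B + |v| * B := by
      refine (abs_sub _ _).trans ?_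
      rw [abs_mul]; gcongr
    gcongr
  have h3 : |b * f * (a₁ - v / 2 * a)| ≤ K * (A * J) * (B + |v|) := by
    rw [abs_mul, abs_mul]
    have : |a₁ - v / 2 * a| ≤ B + |v| := by
      refine (abs_sub _ _).trans ?_
      rw [abs_mul, abs_div, abs_two]
      nlinarith [abs_nonneg a]
    gcongr
  have e : -(v * f₁ * a) * g - f * (a₂ - v * a₁) * g + b * f * (a₁ - v / 2 * a) * g
      = (-(v * f₁ * a) - f * (a₂ - v * a₁) + b * f * (a₁ - v / 2 * a)) * g := by ring
  rw [e, abs_mul, abs_of_nonneg hg]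
  have h4 : |-(v * f₁ * a) - f * (a₂ - v * a₁) + b * f * (a₁ - v / 2 * a)|
      ≤ |v| * (A * J) + A * J * (B + |v| * B) + K * (A * J) * (B + |v|) := by
    refine (abs_add_le _ _).trans (add_le_add ((abs_sub _ _).trans (add_le_add ?_ h2)) h3)
    rwa [abs_neg]
  refine (mul_le_mul_of_nonneg_right h4 hg).trans ?_
  have h5 : |v| * (A * J) + A * J * (B + |v| * B) + K * (A * J) * (B + |v|)
      ≤ A * (1 + B) * (2 + K) * (J * (1 + |v|)) := by
    have hAJ : 0 ≤ A * J := mul_nonneg hA hJ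
    have : |v| + (B + |v| * B) + K * (B + |v|) ≤ (1 + B) * (2 + K) * (1 + |v|) := by
      have := mul_nonneg hB hv
      have := mul_nonneg hK hv
      have := mul_nonneg hK hB
      have := mul_nonneg this hv
      nlinarith
    calc _ = A * J * (|v| + (B + |v| * B) + K * (B + |v|)) := by ring
      _ ≤ A * J * ((1 + B) * (2 + K) * (1 + |v|)) := mul_le_mul_of_nonneg_left this hAJ
      _ = _ := by ring
  calc _ ≤ A * (1 + B) * (2 + K) * (J * (1 + |v|)) * g := mul_le_mul_of_nonneg_right h5 hg
    _ = _ := by ring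

/-- Distributional solutions of `Pu = 0` with moderate growth in `x` satisfy `⟨Wu, γ₀⟩ = 0`. -/
lemma integral_mul_deriv_mul_gam0_eq_zero {V : ℝ → ℝ} {ρ s : ℝ} {u g : Phase → ℂ} (hρ : 2 < ρ)
    (hV : VDecay V ρ) (hs : s < ρ - 1 / 2) (hw : WeakDv u g)
    (hum : AEStronglyMeasurable u (volume : Measure Phase))
    (hgm : AEStronglyMeasurable g (volume : Measure Phase))
    (hu : Integrable (fun p : Phase => ‖u p‖ ^ 2 * jbr (2 * -s) p.1))
    (hg : Integrable (fun p : Phase => ‖g p‖ ^ 2 * jbr (2 * -s) p.1))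
    (hP : ∀ φ : Phase → ℂ, IsTest φ → ∫ p : Phase, u p * KFPt V φ p = 0) :
    ∫ p : Phase, g p * (((deriv V p.1 : ℝ) : ℂ) * gam0 p) = 0 := by
  obtain ⟨K, hK0, hK⟩ := hV.exists_bound (by linarith)
  have hVc : Continuous (deriv V) := hV.1.continuous_deriv le_rfl
  obtain ⟨B, hB0, hB⟩ := exists_cutoff
  have hN (n : ℕ) : (1 : ℝ) ≤ n + 1 := by linarith [(Nat.cast_nonneg n : (0 : ℝ) ≤ n)]
  have hN0 (n : ℕ) : (0 : ℝ) < n + 1 := by linarith [hN n]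
  choose χ χ₁ χ₂ hχs hχc hχ hχ₁ hχb hχ0 hχ1 using fun n : ℕ => hB (n + 1) (hN n)
  set c : ℝ → ℝ := fun x => 1 - Real.exp (-V x / 2) with hc_def
  have hcs : ContDiff ℝ 1 c := contDiff_const.sub ((hV.1.neg.div_const 2).exp)
  have hVd (x : ℝ) : HasDerivAt V (deriv V x) x := (hV.1.differentiable (by simp) x).hasDerivAt
  have hc' (x : ℝ) : deriv c x = deriv V x / 2 * Real.exp (-V x / 2) := by
    refine HasDerivAt.deriv ?_
    exact (((hVd x).neg.div_const 2).exp.const_sub 1).congr_deriv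
      (by simp only [Pi.neg_apply]; ring)
  choose h hhs hh using fun n : ℕ => exists_smooth_approx hcs (M := 2 * ((n : ℝ) + 1))
    (ε := jbr (-ρ) (2 * ((n : ℝ) + 1)) / (n + 1)) (by linarith [hN n])
    (div_pos (jbr_pos _ _) (hN0 n))
  have hJ1 (x : ℝ) : jbr (-ρ) x ≤ 1 := jbr_neg_le_one (by linarith) x
  have hε1 (n : ℕ) (x : ℝ) (hx : |x| ≤ 2 * ((n : ℝ) + 1)) :
      jbr (-ρ) (2 * ((n : ℝ) + 1)) / (n + 1) ≤ jbr (-ρ) x :=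
    (div_le_self (jbr_pos _ _).le (hN n)).trans
      (jbr_neg_le_of_abs_le (by linarith) (hx.trans (le_abs_self _)))
  have hε2 (n : ℕ) : jbr (-ρ) (2 * ((n : ℝ) + 1)) / (n + 1) ≤ 1 / ((n : ℝ) + 1) :=
    div_le_div_of_nonneg_right (hJ1 _) (hN0 n).le
  have hhb (n : ℕ) (x : ℝ) (hx : |x| ≤ 2 * ((n : ℝ) + 1)) :
      |h n x| ≤ (K + 1) * jbr (-ρ) x ∧ |deriv (h n) x| ≤ (K + 1) * jbr (-ρ) x := by
    obtain ⟨h1, h2⟩ := hh n x hx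
    obtain ⟨k1, k2, -⟩ := hK x
    rw [← hc'] at k2
    have h3 := abs_sub_abs_le_abs_sub (h n x) (c x)
    have h4 := abs_sub_abs_le_abs_sub (deriv (h n) x) (deriv c x)
    have h5 := hε1 n x hx
    constructor <;> linarith
  have hlarge (x : ℝ) : ∀ᶠ n : ℕ in atTop, |x| < (n : ℝ) + 1 := by
    filter_upwards [(tendsto_natCast_atTop_atTop (R := ℝ)).eventually_gt_atTop |x|] with n hn
    linarith
  have hlim {y : ℕ → ℝ} {a x : ℝ} (hy : ∀ n : ℕ, |x| ≤ 2 * ((n : ℝ) + 1) →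
      |y n - a| ≤ jbr (-ρ) (2 * ((n : ℝ) + 1)) / (n + 1)) : Tendsto y atTop (𝓝 a) := by
    rw [tendsto_iff_dist_tendsto_zero]
    refine squeeze_zero' (Eventually.of_forall fun _ => dist_nonneg) ?_
      tendsto_one_div_add_atTop_nhds_zero_nat
    filter_upwards [hlarge x] with n hn
    exact (hy n (by linarith [hN0 n])).trans (hε2 n)
  set A : ℝ := (K + 1) * (1 + B) with hA_def
  have hA0 : 0 ≤ A := by positivity
  set L : ℝ := A * (1 + B) * (2 + K) * (4 * psi0 0) with hL_def
  have hAL (x v : ℝ) : A * (1 + B) * (2 + K) * (jbr (-ρ) x * ((1 + |v|) * psi0 v))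
      ≤ L * (jbr (-ρ) x * Real.exp (-(v ^ 2) / 8)) := by
    calc _ ≤ A * (1 + B) * (2 + K) *
          (jbr (-ρ) x * (4 * psi0 0 * Real.exp (-(v ^ 2) / 8))) :=
          mul_le_mul_of_nonneg_left (mul_le_mul_of_nonneg_left (one_add_abs_mul_psi0_le v)
            (jbr_pos _ _).le) (by positivity)
      _ = _ := by ring
  have hKJ (x : ℝ) : K * jbr (-ρ) x ≤ A * jbr (-ρ) x :=
    mul_le_mul_of_nonneg_right (by nlinarith) (jbr_pos _ _).le
  have hVK (x : ℝ) : |deriv V x| ≤ K :=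
    (hK x).2.2.trans (mul_le_of_le_one_right hK0 (hJ1 x))
  have hDm : AEStronglyMeasurable (fun p : Phase =>
      L * (jbr (-ρ) p.1 * Real.exp (-(p.2 ^ 2) / 8))) volume :=
    (((continuous_jbr _).comp continuous_fst).mul (by fun_prop)).const_mul L
      |>.aestronglyMeasurable
  have hDi := integrable_weighted_gaussian hs L
  have hk (n : ℕ) (v : ℝ) : HasDerivAt (fun v => χ n v * psi0 v)
      (χ₁ n v * psi0 v + χ n v * (-v / 2 * psi0 v)) v := (hχ n v).mul (hasDerivAt_psi0 v)
  have hk₁ (n : ℕ) (v : ℝ) : HasDerivAt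
      (fun v => χ₁ n v * psi0 v + χ n v * (-v / 2 * psi0 v))
      (χ₂ n v * psi0 v + χ₁ n v * (-v / 2 * psi0 v) + (χ₁ n v * (-v / 2 * psi0 v)
        + χ n v * ((v ^ 2 / 4 - 1 / 2) * psi0 v))) v :=
    ((hχ₁ n v).mul (hasDerivAt_psi0 v)).add ((hχ n v).mul (hasDerivAt_deriv_psi0 v))
  have hf (n : ℕ) (x : ℝ) : HasDerivAt (fun x => h n x * χ n x)
      (deriv (h n) x * χ n x + h n x * χ₁ n x) x :=
    ((hhs n).differentiable (by simp) x).hasDerivAt.mul (hχ n x)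
  have hfb (n : ℕ) (x : ℝ) : |h n x * χ n x| ≤ A * jbr (-ρ) x ∧
      |deriv (h n) x * χ n x + h n x * χ₁ n x| ≤ A * jbr (-ρ) x := by
    have hAJ : 0 ≤ A * jbr (-ρ) x := mul_nonneg hA0 (jbr_pos _ _).le
    have hKJ0 : 0 ≤ (K + 1) * jbr (-ρ) x := mul_nonneg (by linarith) (jbr_pos _ _).le
    by_cases hx : |x| ≤ 2 * ((n : ℝ) + 1)
    · obtain ⟨h1, h2⟩ := hhb n x hx
      obtain ⟨c1, c2, -⟩ := hχb n x
      have a1 : |h n x * χ n x| ≤ (K + 1) * jbr (-ρ) x * 1 := by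
        rw [abs_mul]; gcongr
      have a2 : |deriv (h n) x * χ n x| ≤ (K + 1) * jbr (-ρ) x * 1 := by
        rw [abs_mul]; gcongr
      have a3 : |h n x * χ₁ n x| ≤ (K + 1) * jbr (-ρ) x * B := by
        rw [abs_mul]; gcongr
      have a4 : 0 ≤ (K + 1) * jbr (-ρ) x * B := (abs_nonneg _).trans a3
      have a5 : A * jbr (-ρ) x = (K + 1) * jbr (-ρ) x * 1 + (K + 1) * jbr (-ρ) x * B := by
        rw [hA_def]; ring
      rw [a5]
      exact ⟨by linarith, (abs_add_le _ _).trans (by linarith)⟩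
    · obtain ⟨c1, c2⟩ := hχ0 n x (not_le.1 hx)
      simpa [c1, c2] using hAJ
  have hψs (n : ℕ) : ContDiff ℝ (⊤ : ℕ∞) fun v => χ n v * psi0 v := (hχs n).mul contDiff_psi0
  have hψc (n : ℕ) : HasCompactSupport fun v => χ n v * psi0 v := (hχc n).mul_right
  have hΦ (n : ℕ) : IsTest fun q : Phase =>
      (((fun x => h n x * χ n x) q.1 * (fun v => χ n v * psi0 v) q.2 : ℝ) : ℂ) :=
    IsTest.tensor ((hhs n).mul (hχs n)) (hψs n) (hχc n).mul_left (hψc n)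
  -- test functions approximating `(1 - exp (-V / 2)) γ₀`
  have key1 : ∫ p : Phase, u p * (((deriv V p.1 : ℝ) : ℂ) *
      ((-p.2 / 2 * psi0 p.2 : ℝ) : ℂ)) = 0 := by
    refine tendsto_nhds_unique (tendsto_integral_mul_of_weighted (s := s) hum hu hDm hDi
      (fun n => ((hΦ n).continuous_KFPt hVc).aestronglyMeasurable) (fun n p => ?_)
      (fun p => ?_)) (tendsto_const_nhds.congr fun n => (hP _ (hΦ n)).symm)
    · rw [KFPt_tensor V (hf n) (hk n) (hk₁ n), Complex.norm_real, Real.norm_eq_abs]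
      obtain ⟨c1, c2, c3⟩ := hχb n p.2
      refine le_trans (le_of_eq ?_) ((abs_cutoff_expr_le hB0 hK0 (jbr_pos (-ρ) p.1).le hA0
        (psi0_pos p.2).le (hfb n p.1).1 (hfb n p.1).2 c1 c2 c3 (hVK p.1)).trans
        (hAL p.1 p.2) : _)
      congr 1; ring
    · have l1 : Tendsto (fun n => h n p.1) atTop (𝓝 (c p.1)) := hlim fun n hn => (hh n _ hn).1
      have l2 : Tendsto (fun n => deriv (h n) p.1) atTop (𝓝 (deriv c p.1)) :=
        hlim fun n hn => (hh n _ hn).2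
      have l3 : Tendsto (fun n => (-(p.2 * deriv (h n) p.1) - deriv V p.1 * h n p.1 * (p.2 / 2))
          * psi0 p.2) atTop (𝓝 (deriv V p.1 * (-p.2 / 2 * psi0 p.2))) := by
        have := (((l2.const_mul p.2).neg.sub ((l1.const_mul (deriv V p.1)).mul_const
          (p.2 / 2)))).mul_const (psi0 p.2)
        convert this using 2
        rw [hc', hc_def]; ring
      have l4 := (Complex.continuous_ofReal.tendsto _).comp l3
      rw [Complex.ofReal_mul] at l4
      refine l4.congr' ?_
      filter_upwards [hlarge p.1, hlarge p.2] with n h1 h2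
      obtain ⟨a1, a2, a3⟩ := hχ1 n _ h1
      obtain ⟨b1, b2, b3⟩ := hχ1 n _ h2
      rw [KFPt_tensor V (hf n) (hk n) (hk₁ n), Function.comp_apply, a1, a2, b1, b2, b3]
      congr 1; ring
  have hΨ (n : ℕ) : IsTest fun q : Phase =>
      ((χ n q.1 * (fun v => χ n v * psi0 v) q.2 : ℝ) : ℂ) :=
    IsTest.tensor (hχs n) (hψs n) (hχc n) (hψc n)
  have hVm : Continuous fun p : Phase => ((deriv V p.1 : ℝ) : ℂ) :=
    Complex.continuous_ofReal.comp (hVc.comp continuous_fst)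
  have hVχ (n : ℕ) (x : ℝ) : |deriv V x * χ n x| ≤ A * jbr (-ρ) x := by
    rw [abs_mul]
    calc |deriv V x| * |χ n x| ≤ |deriv V x| * 1 := by gcongr; exact (hχb n x).1
      _ ≤ A * jbr (-ρ) x := by rw [mul_one]; exact (hK x).2.2.trans (hKJ x)
  have hbound {a b v x : ℝ} (ha : |a| ≤ A * jbr (-ρ) x) (hb : |b| ≤ (1 + B) * (1 + |v|)) :
      |a * (b * psi0 v)| ≤ L * (jbr (-ρ) x * Real.exp (-(v ^ 2) / 8)) := by
    refine le_trans ?_ (hAL x v)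
    have hAJ : 0 ≤ A * jbr (-ρ) x := mul_nonneg hA0 (jbr_pos _ _).le
    have hp : 0 ≤ A * jbr (-ρ) x * ((1 + B) * (1 + |v|) * psi0 v) :=
      mul_nonneg hAJ (mul_nonneg (by positivity) (psi0_pos v).le)
    rw [abs_mul, abs_mul, abs_of_pos (psi0_pos v)]
    calc |a| * (|b| * psi0 v) ≤ A * jbr (-ρ) x * ((1 + B) * (1 + |v|) * psi0 v) := by
          have := (psi0_pos v).le
          gcongr
      _ ≤ A * jbr (-ρ) x * ((1 + B) * (1 + |v|) * psi0 v) * (2 + K) :=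
          le_mul_of_one_le_right hp (by linarith)
      _ = _ := by ring
  have l1 : Tendsto (fun n => ∫ p : Phase, u p * (((deriv V p.1 : ℝ) : ℂ) *
      dvD (fun q : Phase => ((χ n q.1 * (fun v => χ n v * psi0 v) q.2 : ℝ) : ℂ)) p)) atTop
      (𝓝 (∫ p : Phase, u p * (((deriv V p.1 : ℝ) : ℂ) *
        ((-p.2 / 2 * psi0 p.2 : ℝ) : ℂ)))) := by
    refine tendsto_integral_mul_of_weighted (s := s) hum hu hDm hDi
      (fun n => (hVm.mul (hΨ n).dvD.1.continuous).aestronglyMeasurable) (fun n p => ?_)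
      (fun p => ?_)
    · rw [dvD_tensor (hχ n _) (hk n _), ← Complex.ofReal_mul, Complex.norm_real,
        Real.norm_eq_abs]
      have e : deriv V p.1 * (χ n p.1 * (χ₁ n p.2 * psi0 p.2 + χ n p.2 * (-p.2 / 2 * psi0 p.2)))
          = deriv V p.1 * χ n p.1 * ((χ₁ n p.2 + χ n p.2 * (-p.2 / 2)) * psi0 p.2) := by ring
      rw [e]
      refine hbound (hVχ n p.1) ((abs_add_le _ _).trans ?_)
      obtain ⟨c1, c2, -⟩ := hχb n p.2
      rw [abs_mul, abs_div, abs_neg, abs_two]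
      nlinarith [abs_nonneg p.2, mul_nonneg hB0 (abs_nonneg p.2)]
    · refine tendsto_const_nhds.congr' ?_
      filter_upwards [hlarge p.1, hlarge p.2] with n h1 h2
      obtain ⟨a1, -, -⟩ := hχ1 n _ h1
      obtain ⟨b1, b2, -⟩ := hχ1 n _ h2
      rw [dvD_tensor (hχ n _) (hk n _), a1, b1, b2]
      congr 2; ring
  have l2 : Tendsto (fun n => ∫ p : Phase, g p * (((deriv V p.1 : ℝ) : ℂ) *
      ((χ n p.1 * (fun v => χ n v * psi0 v) p.2 : ℝ) : ℂ))) atTop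
      (𝓝 (∫ p : Phase, g p * (((deriv V p.1 : ℝ) : ℂ) * gam0 p))) := by
    refine tendsto_integral_mul_of_weighted (s := s) hgm hg hDm hDi
      (fun n => (hVm.mul (hΨ n).1.continuous).aestronglyMeasurable) (fun n p => ?_)
      (fun p => ?_)
    · rw [← Complex.ofReal_mul, Complex.norm_real, Real.norm_eq_abs, ← mul_assoc]
      refine hbound (hVχ n p.1) ((hχb n p.2).1.trans ?_)
      nlinarith [abs_nonneg p.2, mul_nonneg hB0 (abs_nonneg p.2)]
    · refine tendsto_const_nhds.congr' ?_
      filter_upwards [hlarge p.1, hlarge p.2] with n h1 h2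
      rw [(hχ1 n _ h1).1]
      simp [(hχ1 n _ h2).1, gam0]
  rw [key1] at l1
  have l3 := l2.neg.congr fun n => (hw.integral_mul_continuous hum hgm hu hg hVc (hΨ n)).symm
  exact neg_eq_zero.1 (tendsto_nhds_unique l3 l1)

/-- **Lemma 4.2**.  Let n = 1 and ρ > 2.  If u ∈ ℋ^{1,−s} for some 3/2 < s < (ρ+1)/2
satisfies (1 + G₀W)u = βγ₀ for some β ∈ ℂ, then Pu = 0 in the sense of distributions;
in particular ⟨Wu, γ₀⟩ = 0. -/
theorem statement12
    (V : ℝ → ℝ) (ρ : ℝ) (hρ : 2 < ρ) (hV : VDecay V ρ)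
    (R : ℂ → Hsp →L[ℂ] Hsp) (hR : IsResolvent (fun _ => 0) R offRplus)
    (s : ℝ) (hs1 : 3 / 2 < s) (hs2 : s < (ρ + 1) / 2)
    (u g w : Phase → ℂ) (hu : MemH1 (-s) u g) (hw : IsG0W V R g w)
    (β : ℂ) (heq : ∀ᵐ p : Phase, u p + w p = β * gam0 p) :
    (∀ φ : Phase → ℂ, IsTest φ → ∫ p : Phase, u p * KFPt V φ p = 0) ∧
    ∫ p : Phase, Wfun V g p * (starRingEnd ℂ) (gam0 p) = 0 := by
  obtain ⟨hum, hgm, hwd, hu2, hg2, -, -⟩ := hu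
  have hVc : Continuous (deriv V) := hV.1.continuous_deriv le_rfl
  have hP : ∀ φ : Phase → ℂ, IsTest φ → ∫ p : Phase, u p * KFPt V φ p = 0 := by
    intro φ hφ
    have h0 := hφ.KFPt_zero
    have iu := integrable_mul_of_hasCompactSupport hum hu2 h0.1.continuous h0.2
    have iγ : Integrable fun p => β * (gam0 p * KFPt (fun _ => 0) φ p) :=
      ((h0.mul_left contDiff_gam0).1.continuous.integrable_of_hasCompactSupport
        (h0.mul_left contDiff_gam0).2).const_mul β
    have e1 : ∫ p, w p * KFPt (fun _ => 0) φ p = -∫ p, u p * KFPt (fun _ => 0) φ p := by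
      calc ∫ p, w p * KFPt (fun _ => 0) φ p
          = ∫ p, (β * (gam0 p * KFPt (fun _ => 0) φ p) - u p * KFPt (fun _ => 0) φ p) := by
            refine integral_congr_ae ?_
            filter_upwards [heq] with p hp
            linear_combination KFPt (fun _ => 0) φ p * hp
        _ = _ := by
            rw [integral_sub iγ iu, integral_const_mul, integral_gam0_mul_KFPt_zero hφ]
            simp
    have e2 := hw.integral_mul_KFPt_zero hR hφ
    have e3 := hwd.integral_mul_continuous hum hgm hu2 hg2 hVc hφ
    have e4 : ∫ p, Wfun V g p * φ p
        = -∫ p : Phase, g p * (((deriv V p.1 : ℝ) : ℂ) * φ p) := by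
      rw [← integral_neg]
      congr 1; ext p; rw [Wfun]; ring
    have iv : Integrable fun p : Phase => u p * (((deriv V p.1 : ℝ) : ℂ) * dvD φ p) :=
      integrable_mul_of_hasCompactSupport hum hu2
        ((Complex.continuous_ofReal.comp (hVc.comp continuous_fst)).mul hφ.dvD.1.continuous)
        hφ.dvD.2.mul_left
    simp only [KFPt_eq V, mul_add]
    rw [integral_add iu iv]
    linear_combination e1 - e2 + e3 - e4
  refine ⟨hP, ?_⟩
  have h := integral_mul_deriv_mul_gam0_eq_zero hρ hV (by linarith) hwd hum hgm hu2 hg2 hP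
  rw [← neg_eq_zero, ← integral_neg, ← h]
  congr 1; ext p
  simp only [Wfun, gam0, Complex.conj_ofReal]
  ring

end
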